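/- arXiv:2504.02723 — 5 statements merged into one kernel-verified Lean document; each statement's English description precedes it below -/
import Mathlib

section
/- Let Y be a finite set of points in ℝ^d contained in the closed Euclidean ball B(c, R), let μ_Y be the empirical mean of Y, and let Σ_Y be the empirical covariance of Y, whose largest eigenvalue satisfies λ_max(Σ_Y) ≤ σ². Let μ̂ ∈ ℝ^d be an arbitrary point with ‖μ_Y − μ̂‖₂ ≤ τ. Then for any t ≥ 1, there exists a subset Ŷ ⊆ Y with |Ŷ| ≥ (1 − 1/t²)|Y| such that every point y ∈ Ŷ satisfies ‖y − μ̂‖₂² ≤ ‖y − c‖₂² + t²(σ² + τ²). -/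
open Finset
open scoped RealInnerProductSpace

/-- Markov's inequality for finite sums: if the average of `f ≥ 0` over `s` is at most `S`, then at
least a `1 - 1 / t ^ 2` fraction of `s` satisfies `f ≤ t ^ 2 * S`. -/
theorem one_sub_inv_sq_mul_card_le_card_filter_le {α : Type*} (s : Finset α) (f : α → ℝ)
    (hf : ∀ a ∈ s, 0 ≤ f a) {S t : ℝ} (hS : 0 ≤ S) (ht : 0 < t)
    (hsum : ∑ a ∈ s, f a ≤ s.card * S) :
    (1 - 1 / t ^ 2) * (s.card : ℝ) ≤ ((s.filter fun a => f a ≤ t ^ 2 * S).card : ℝ) := by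
  have hcard : ((s.filter fun a => f a ≤ t ^ 2 * S).card : ℝ)
      + ((s.filter fun a => ¬ f a ≤ t ^ 2 * S).card : ℝ) = s.card := by
    rw [← Nat.cast_add, card_filter_add_card_filter_not]
  have ht2 : 0 < t ^ 2 := by positivity
  rcases hS.eq_or_lt with rfl | hSpos
  · rw [filter_true_of_mem fun a ha => ?_]
    · have : 0 ≤ 1 / t ^ 2 * (s.card : ℝ) := by positivity
      linarith
    · have := single_le_sum hf ha
      linarith
  · have hbad : ((s.filter fun a => ¬ f a ≤ t ^ 2 * S).card : ℝ) * (t ^ 2 * S) ≤ s.card * S := by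
      calc _ = ∑ a ∈ s.filter fun a => ¬ f a ≤ t ^ 2 * S, t ^ 2 * S := by simp
        _ ≤ ∑ a ∈ s.filter fun a => ¬ f a ≤ t ^ 2 * S, f a :=
          sum_le_sum fun a ha => (not_le.mp (mem_filter.mp ha).2).le
        _ ≤ ∑ a ∈ s, f a :=
          sum_le_sum_of_subset_of_nonneg (filter_subset _ _) fun a ha _ => hf a ha
        _ ≤ _ := hsum
    have hle : ((s.filter fun a => ¬ f a ≤ t ^ 2 * S).card : ℝ) ≤ s.card / t ^ 2 := by
      rw [le_div_iff₀ ht2]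
      exact le_of_mul_le_mul_right (by linarith) hSpos
    have : (1 - 1 / t ^ 2) * (s.card : ℝ) = s.card - s.card / t ^ 2 := by ring
    linarith

section InnerProductSpace

variable {E : Type*} [NormedAddCommGroup E] [InnerProductSpace ℝ E]

/-- Along a direction `v`, the second moment about `m` is the second moment about the mean `μ` plus
the squared displacement `⟪μ - m, v⟫ ^ 2`. -/
theorem sum_inner_sub_sq_eq (s : Finset E) (μ m v : E) (hμ : μ = (s.card : ℝ)⁻¹ • ∑ y ∈ s, y) :
    ∑ y ∈ s, ⟪y - m, v⟫ ^ 2 = ∑ y ∈ s, ⟪y - μ, v⟫ ^ 2 + s.card * ⟪μ - m, v⟫ ^ 2 := by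
  rcases s.eq_empty_or_nonempty with rfl | hs
  · simp
  have hn : (s.card : ℝ) ≠ 0 := by exact_mod_cast hs.card_pos.ne'
  have hzero : ∑ y ∈ s, ⟪y - μ, v⟫ = 0 := by
    rw [← sum_inner, sum_sub_distrib, sum_const, ← Nat.cast_smul_eq_nsmul ℝ, hμ, smul_smul,
      mul_inv_cancel₀ hn, one_smul, sub_self, inner_zero_left]
  calc ∑ y ∈ s, ⟪y - m, v⟫ ^ 2
      = ∑ y ∈ s, (⟪y - μ, v⟫ ^ 2 + 2 * ⟪μ - m, v⟫ * ⟪y - μ, v⟫ + ⟪μ - m, v⟫ ^ 2) := by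
        refine sum_congr rfl fun y _ => ?_
        rw [← sub_add_sub_cancel y μ m, inner_add_left]
        ring
    _ = _ := by simp [sum_add_distrib, ← mul_sum, hzero]

/-- Moving the reference point from `c` to `m` along a unit vector `v` increases the squared
distance to `y` by at most `⟪y - m, v⟫ ^ 2`. -/
theorem norm_sub_sq_le_add_inner_sq (y c m v : E) (r : ℝ) (hv : ‖v‖ = 1) (hm : m - c = r • v) :
    ‖y - m‖ ^ 2 ≤ ‖y - c‖ ^ 2 + ⟪y - m, v⟫ ^ 2 := by
  rw [← sub_add_sub_cancel y m c, norm_add_sq_real, hm, inner_smul_right, norm_smul, hv, mul_one,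
    Real.norm_eq_abs, sq_abs]
  nlinarith [sq_nonneg (⟪y - m, v⟫ + r)]

end InnerProductSpace

/-- For a finite set of points contained in a ball with bounded empirical
covariance (largest eigenvalue at most `σ²`, stated via the quadratic form), most points are
nearly as close to any approximate mean `μ̂` as they are to the center `c`. -/
theorem bounded_variance_most_points_near_mean
    {d : ℕ} (Y : Finset (EuclideanSpace ℝ (Fin d)))
    (c : EuclideanSpace ℝ (Fin d)) (R : ℝ)
    (hYB : ∀ y ∈ Y, y ∈ Metric.closedBall c R)
    (μY : EuclideanSpace ℝ (Fin d)) (hμY : μY = (Y.card : ℝ)⁻¹ • ∑ y ∈ Y, y)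
    (σ τ : ℝ)
    (hσ : ∀ v : EuclideanSpace ℝ (Fin d), ‖v‖ = 1 →
      (Y.card : ℝ)⁻¹ * ∑ y ∈ Y, ⟪y - μY, v⟫ ^ 2 ≤ σ ^ 2)
    (μhat : EuclideanSpace ℝ (Fin d)) (hμhat : ‖μY - μhat‖ ≤ τ)
    (t : ℝ) (ht : 1 ≤ t) :
    ∃ Yhat ⊆ Y, (1 - 1 / t ^ 2) * (Y.card : ℝ) ≤ (Yhat.card : ℝ) ∧
      ∀ y ∈ Yhat, ‖y - μhat‖ ^ 2 ≤ ‖y - c‖ ^ 2 + t ^ 2 * (σ ^ 2 + τ ^ 2) := by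
  have hS : 0 ≤ σ ^ 2 + τ ^ 2 := by positivity
  have ht0 : 0 < t := by linarith
  rcases eq_or_ne (μhat - c) 0 with hw | hw
  · refine ⟨Y, Subset.rfl, ?_, fun y _ => ?_⟩
    · have : 0 ≤ 1 / t ^ 2 * (Y.card : ℝ) := by positivity
      linarith
    · rw [sub_eq_zero.mp hw]
      exact le_add_of_nonneg_right (by positivity)
  set v := ‖μhat - c‖⁻¹ • (μhat - c) with hv_def
  have hv : ‖v‖ = 1 := norm_smul_inv_norm hw
  have hwv : μhat - c = ‖μhat - c‖ • v := by
    rw [hv_def, smul_smul, mul_inv_cancel₀ (norm_ne_zero_iff.mpr hw), one_smul]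
  have hshift : ⟪μY - μhat, v⟫ ^ 2 ≤ τ ^ 2 := by
    rw [sq_le_sq, abs_of_nonneg ((norm_nonneg _).trans hμhat)]
    have := abs_real_inner_le_norm (μY - μhat) v
    rw [hv, mul_one] at this
    exact this.trans hμhat
  have hvar : ∑ y ∈ Y, ⟪y - μY, v⟫ ^ 2 ≤ Y.card * σ ^ 2 := by
    rcases Y.eq_empty_or_nonempty with rfl | hY
    · simp
    · exact (inv_mul_le_iff₀ (by exact_mod_cast hY.card_pos)).mp (hσ v hv)
  have hsum : ∑ y ∈ Y, ⟪y - μhat, v⟫ ^ 2 ≤ Y.card * (σ ^ 2 + τ ^ 2) := by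
    rw [sum_inner_sub_sq_eq Y μY μhat v hμY, mul_add]
    exact add_le_add hvar (mul_le_mul_of_nonneg_left hshift (Nat.cast_nonneg _))
  refine ⟨Y.filter fun y => ⟪y - μhat, v⟫ ^ 2 ≤ t ^ 2 * (σ ^ 2 + τ ^ 2), filter_subset _ _,
    one_sub_inv_sq_mul_card_le_card_filter_le Y _ (fun y _ => sq_nonneg _) hS ht0 hsum,
    fun y hy => ?_⟩
  exact (norm_sub_sq_le_add_inner_sq y c μhat v _ hv hwv).trans
    (add_le_add_right (mem_filter.mp hy).2 _)
end

section
/- Let B' = B(0, R') be a ball in ℝ^d containing a finite set of points Y' whose empirical covariance Σ_{Y'} has largest eigenvalue at most σ². Suppose there is a subset Y* ⊆ Y' contained in a ball B* = B(c*, R*) with |Y*| ≥ δ|Y'|, and let γ ∈ (0,1). Then, taking ĉ to be the empirical mean of Y', there exists a subset Ŷ ⊆ Y* with |Ŷ| ≥ (1 − γ)|Y*| such that every y ∈ Ŷ satisfies ‖y − ĉ‖₂² ≤ ‖y − c*‖₂² + (σ²/γ)·(1 + 2(1 − δ)/δ). -/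
open Finset
open scoped RealInnerProductSpace

/-- Markov's inequality for counting: if `∑ f ≤ |s| * (a * K)` with `f, K ≥ 0`, then at least a
`1 - a` fraction of `s` satisfies `f ≤ K`. -/
theorem one_sub_mul_card_le_card_filter_le {ι : Type*} (s : Finset ι) (f : ι → ℝ) (K a : ℝ)
    (hf : ∀ i ∈ s, 0 ≤ f i) (hK : 0 ≤ K) (ha : 0 ≤ a) (hsum : ∑ i ∈ s, f i ≤ s.card * (a * K)) :
    (1 - a) * (s.card : ℝ) ≤ ((s.filter fun i => f i ≤ K).card : ℝ) := by
  have hcard : ((s.filter fun i => f i ≤ K).card : ℝ) + ((s.filter fun i => ¬ f i ≤ K).card : ℝ)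
      = s.card := by
    exact_mod_cast s.card_filter_add_card_filter_not fun i => f i ≤ K
  by_contra! h
  have hbad : a * s.card < ((s.filter fun i => ¬ f i ≤ K).card : ℝ) := by linarith
  have hne : (s.filter fun i => ¬ f i ≤ K).Nonempty := by
    rw [← Finset.card_pos]
    exact_mod_cast (by positivity : (0 : ℝ) ≤ a * s.card).trans_lt hbad
  have hlt : ((s.filter fun i => ¬ f i ≤ K).card : ℝ) * K < ∑ i ∈ s, f i :=
    calc ((s.filter fun i => ¬ f i ≤ K).card : ℝ) * K
        = ∑ _i ∈ s.filter fun i => ¬ f i ≤ K, K := by simp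
      _ < ∑ i ∈ s.filter fun i => ¬ f i ≤ K, f i :=
        Finset.sum_lt_sum_of_nonempty hne fun i hi => not_le.mp (Finset.mem_filter.mp hi).2
      _ ≤ ∑ i ∈ s, f i :=
        Finset.sum_le_sum_of_subset_of_nonneg (Finset.filter_subset _ _) fun i hi _ => hf i hi
  nlinarith [mul_le_mul_of_nonneg_right hbad.le hK]

/-- Replacing the center `b` by `a` increases the squared distance to `y` by at most the square of
the component of `y - a` along a unit vector in the direction of `b - a`. -/
theorem norm_sub_sq_le_add_inner_sq_s7 {E : Type*} [NormedAddCommGroup E] [InnerProductSpace ℝ E]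
    (y a b v : E) (t : ℝ) (hv : ‖v‖ = 1) (hb : b - a = t • v) :
    ‖y - a‖ ^ 2 ≤ ‖y - b‖ ^ 2 + ⟪y - a, v⟫ ^ 2 := by
  have h : y - b = (y - a) - t • v := by rw [← hb]; abel
  rw [h, norm_sub_sq_real (y - a), real_inner_smul_right, norm_smul, hv, mul_one, Real.norm_eq_abs, sq_abs]
  nlinarith [sq_nonneg (⟪y - a, v⟫ - t)]

theorem mul_sq_le_mul_of_mul_le {n m σ δ γ : ℝ} (hδ0 : 0 < δ) (hδ1 : δ ≤ 1) (hγ0 : 0 < γ)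
    (hm : 0 ≤ m) (h : δ * n ≤ m) :
    n * σ ^ 2 ≤ m * (γ * ((σ ^ 2 / γ) * (1 + 2 * (1 - δ) / δ))) := by
  have hδ : 0 ≤ 1 - δ := by linarith
  have hγ : γ * ((σ ^ 2 / γ) * (1 + 2 * (1 - δ) / δ)) = σ ^ 2 / δ + σ ^ 2 * (1 - δ) / δ := by
    field_simp
    ring
  have hle : σ ^ 2 / δ ≤ γ * ((σ ^ 2 / γ) * (1 + 2 * (1 - δ) / δ)) :=
    hγ ▸ le_add_of_nonneg_right (by positivity)
  calc n * σ ^ 2 = (δ * n) * (σ ^ 2 / δ) := by field_simp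
    _ ≤ m * (γ * ((σ ^ 2 / γ) * (1 + 2 * (1 - δ) / δ))) := by gcongr

/-- **Coarse-to-fine refinement, `q = 0` case.** If `Y' ⊆ B(0,R')` has empirical
covariance with largest eigenvalue at most `σ²` (stated via the quadratic form) and
`Y* ⊆ Y'` with `|Y*| ≥ δ|Y'|` lies in a ball `B(c*, R*)`, then taking `ĉ` to be the
empirical mean of `Y'`, a `(1-γ)` fraction of `Y*` satisfies
`‖y - ĉ‖² ≤ ‖y - c*‖² + (σ²/γ)(1 + 2(1-δ)/δ)`. -/
theorem coarse_to_fine_mean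
    {d : ℕ} (Y' Ystar : Finset (EuclideanSpace ℝ (Fin d)))
    (R' Rstar σ δ γ : ℝ) (cstar : EuclideanSpace ℝ (Fin d))
    (hY' : ∀ y ∈ Y', y ∈ Metric.closedBall (0 : EuclideanSpace ℝ (Fin d)) R')
    (chat : EuclideanSpace ℝ (Fin d)) (hchat : chat = (Y'.card : ℝ)⁻¹ • ∑ y ∈ Y', y)
    (hσ : ∀ v : EuclideanSpace ℝ (Fin d), ‖v‖ = 1 →
      (Y'.card : ℝ)⁻¹ * ∑ y ∈ Y', ⟪y - chat, v⟫ ^ 2 ≤ σ ^ 2)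
    (hsub : Ystar ⊆ Y')
    (hYstarB : ∀ y ∈ Ystar, y ∈ Metric.closedBall cstar Rstar)
    (hδ0 : 0 < δ) (hδ1 : δ ≤ 1) (hcard : δ * (Y'.card : ℝ) ≤ (Ystar.card : ℝ))
    (hγ0 : 0 < γ) (hγ1 : γ < 1) :
    ∃ Yhat ⊆ Ystar, (1 - γ) * (Ystar.card : ℝ) ≤ (Yhat.card : ℝ) ∧
      ∀ y ∈ Yhat,
        ‖y - chat‖ ^ 2 ≤ ‖y - cstar‖ ^ 2 + (σ ^ 2 / γ) * (1 + 2 * (1 - δ) / δ) := by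
  set K := (σ ^ 2 / γ) * (1 + 2 * (1 - δ) / δ) with hKdef
  have hδ : 0 ≤ 1 - δ := by linarith
  have hK : 0 ≤ K := by positivity
  rcases eq_or_ne cstar chat with rfl | hne
  · exact ⟨Ystar, subset_rfl, by nlinarith [Ystar.card.cast_nonneg (α := ℝ)],
      fun y _ => le_add_of_nonneg_right hK⟩
  have hw : ‖cstar - chat‖ ≠ 0 := norm_ne_zero_iff.mpr (sub_ne_zero.mpr hne)
  set v := ‖cstar - chat‖⁻¹ • (cstar - chat) with hvdef
  have hv : ‖v‖ = 1 := by rw [hvdef, norm_smul, norm_inv, norm_norm, inv_mul_cancel₀ hw]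
  have hwv : cstar - chat = ‖cstar - chat‖ • v := by rw [hvdef, smul_inv_smul₀ hw]
  have hsum : ∑ y ∈ Ystar, ⟪y - chat, v⟫ ^ 2 ≤ Ystar.card * (γ * K) := by
    have hYsum : ∑ y ∈ Y', ⟪y - chat, v⟫ ^ 2 ≤ Y'.card * σ ^ 2 := by
      rcases Y'.eq_empty_or_nonempty with rfl | hY
      · simp
      · exact (inv_mul_le_iff₀ (by exact_mod_cast hY.card_pos)).mp (hσ v hv)
    calc ∑ y ∈ Ystar, ⟪y - chat, v⟫ ^ 2
        ≤ ∑ y ∈ Y', ⟪y - chat, v⟫ ^ 2 :=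
          Finset.sum_le_sum_of_subset_of_nonneg hsub fun _ _ _ => sq_nonneg _
      _ ≤ Y'.card * σ ^ 2 := hYsum
      _ ≤ Ystar.card * (γ * K) := mul_sq_le_mul_of_mul_le hδ0 hδ1 hγ0 Ystar.card.cast_nonneg hcard
  refine ⟨Ystar.filter fun y => ⟪y - chat, v⟫ ^ 2 ≤ K, Finset.filter_subset _ _,
    one_sub_mul_card_le_card_filter_le _ _ K γ (fun _ _ => sq_nonneg _) hK hγ0.le hsum, ?_⟩
  intro y hy
  exact (norm_sub_sq_le_add_inner_sq_s7 y chat cstar v _ hv hwv).trans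
    (add_le_add_right (Finset.mem_filter.mp hy).2 _)
end

section
/- Let B' = B(0, R') be a ball in ℝ^d containing a finite set of points Y', and let q ≥ 1 be an integer such that the (q+1)-th largest eigenvalue of the empirical covariance Σ_{Y'} satisfies λ_{q+1}(Σ_{Y'}) ≤ σ². Suppose there is a subset Y* ⊆ Y' contained in a ball B* = B(c*, R*) with |Y*| ≥ δ|Y'| and R' ≤ 2R*, and let γ ∈ (0,1) and 0 < τ < R'. Let Π_high be the orthogonal projection onto a top-q eigenspace of Σ_{Y'} and Π_low = I − Π_high. Then there exists a finite list C ⊂ ℝ^d of size at most (3R'/τ)^q, a subset Ŷ ⊆ Y* with |Ŷ| ≥ (1 − γ)|Y*|, and a point ĉ ∈ C such that every y ∈ Ŷ satisfies ‖y − ĉ‖₂² ≤ ‖Π_low(y − c*)‖₂² + (σ²/γ)·(1 + 2(1 − δ)/δ) + (‖Π_high(y − c*)‖₂ + τ)². -/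
open Finset
open scoped RealInnerProductSpace

open MeasureTheory Module in
/-- A `τ`-separated finite subset of the ball of radius `R` has at most `(1 + 2R/τ)^dim` points. -/
theorem card_le_pow_finrank_of_separated {E : Type*} [NormedAddCommGroup E] [NormedSpace ℝ E]
    [FiniteDimensional ℝ E] {R τ : ℝ} (hR : 0 ≤ R) (hτ : 0 < τ) (s : Finset E)
    (hs : ∀ c ∈ s, ‖c‖ ≤ R) (hsep : ∀ c ∈ s, ∀ c' ∈ s, c ≠ c' → τ < ‖c - c'‖) :
    (s.card : ℝ) ≤ (1 + 2 * R / τ) ^ finrank ℝ E := by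
  borelize E
  let ν : Measure E := Measure.addHaar
  have hτ2 : 0 < τ / 2 := by positivity
  have hρ : 0 < τ / 2 + R := by positivity
  have hdisj : Set.Pairwise (s : Set E)
      (Function.onFun Disjoint fun c => Metric.ball (c : E) (τ / 2)) := by
    intro c hc c' hc' hne
    apply Metric.ball_disjoint_ball
    rw [dist_eq_norm]
    linarith [hsep c hc c' hc' hne]
  have hsubset : (⋃ c ∈ s, Metric.ball (c : E) (τ / 2)) ⊆ Metric.ball (0 : E) (τ / 2 + R) := by
    refine Set.iUnion₂_subset fun c hc => Metric.ball_subset_ball' ?_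
    rw [dist_zero_right]
    linarith [hs c hc]
  have hvol : (s.card : ENNReal) * ENNReal.ofReal ((τ / 2) ^ finrank ℝ E) *
      ν (Metric.ball 0 1) ≤
        ENNReal.ofReal ((τ / 2 + R) ^ finrank ℝ E) * ν (Metric.ball 0 1) :=
    calc
      _ = ν (⋃ c ∈ s, Metric.ball (c : E) (τ / 2)) := by
        rw [measure_biUnion_finset hdisj fun c _ => measurableSet_ball]
        simp only [ν.addHaar_ball_of_pos _ hτ2, Finset.sum_const, nsmul_eq_mul, mul_assoc]
      _ ≤ ν (Metric.ball (0 : E) (τ / 2 + R)) := measure_mono hsubset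
      _ = _ := by simp only [ν.addHaar_ball_of_pos _ hρ]
  have hcancel := (ENNReal.mul_le_mul_iff_left
    (Metric.measure_ball_pos ν _ zero_lt_one).ne' measure_ball_lt_top.ne).1 hvol
  have hreal := ENNReal.toReal_le_of_le_ofReal (pow_nonneg hρ.le _) hcancel
  rw [ENNReal.toReal_mul, ENNReal.toReal_natCast, ENNReal.toReal_ofReal (by positivity)] at hreal
  have hfactor : τ / 2 + R = (1 + 2 * R / τ) * (τ / 2) := by field_simp
  rw [hfactor, mul_pow] at hreal
  exact le_of_mul_le_mul_right hreal (by positivity)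

open Module in
/-- A finite-dimensional ball of radius `R` has a `τ`-net with at most `(1 + 2R/τ)^dim` points. -/
theorem exists_finset_net_closedBall {E : Type*} [NormedAddCommGroup E] [NormedSpace ℝ E]
    [FiniteDimensional ℝ E] {R τ : ℝ} (hR : 0 ≤ R) (hτ : 0 < τ) :
    ∃ s : Finset E, (s.card : ℝ) ≤ (1 + 2 * R / τ) ^ finrank ℝ E ∧
      ∀ x : E, ‖x‖ ≤ R → ∃ c ∈ s, ‖x - c‖ ≤ τ := by
  classical
  by_contra! hno
  have hlarge : ∀ n : ℕ, ∃ s : Finset E, s.card = n ∧ (∀ c ∈ s, ‖c‖ ≤ R) ∧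
      ∀ c ∈ s, ∀ c' ∈ s, c ≠ c' → τ < ‖c - c'‖ := by
    intro n
    induction n with
    | zero => exact ⟨∅, by simp⟩
    | succ n ih =>
      obtain ⟨s, hcard, hs, hsep⟩ := ih
      obtain ⟨x, hx, hfar⟩ := hno s (card_le_pow_finrank_of_separated hR hτ s hs hsep)
      have hxs : x ∉ s := fun h => by
        have := hfar x h
        simp only [sub_self, norm_zero] at this
        linarith
      refine ⟨insert x s, by rw [Finset.card_insert_of_notMem hxs, hcard], ?_, ?_⟩
      · intro c hc
        rcases Finset.mem_insert.1 hc with rfl | hc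
        exacts [hx, hs c hc]
      · intro c hc c' hc' hne
        rcases Finset.mem_insert.1 hc with rfl | hcs <;>
          rcases Finset.mem_insert.1 hc' with rfl | hcs'
        · exact absurd rfl hne
        · exact hfar c' hcs'
        · rw [norm_sub_rev]
          exact hfar c hcs
        · exact hsep c hcs c' hcs' hne
  obtain ⟨n, hn⟩ := exists_nat_gt ((1 + 2 * R / τ) ^ finrank ℝ E)
  obtain ⟨s, rfl, hs, hsep⟩ := hlarge n
  exact absurd (card_le_pow_finrank_of_separated hR hτ s hs hsep) (not_le.2 hn)

/-- Every point `z` has a point of the ball of radius `R` that is at least as close as `z` to all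
points of that ball. -/
theorem exists_norm_le_forall_norm_sub_le {E : Type*} [NormedAddCommGroup E]
    [InnerProductSpace ℝ E] {R : ℝ} (hR : 0 ≤ R) (z : E) :
    ∃ p : E, ‖p‖ ≤ R ∧ ∀ u : E, ‖u‖ ≤ R → ‖u - p‖ ≤ ‖u - z‖ := by
  rcases le_or_gt ‖z‖ R with hz | hz
  · exact ⟨z, hz, fun _ _ => le_rfl⟩
  have hz0 : 0 < ‖z‖ := hR.trans_lt hz
  obtain ⟨a, ha⟩ : ∃ a, a = R / ‖z‖ := ⟨_, rfl⟩
  have haz : a * ‖z‖ = R := by rw [ha]; field_simp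
  have ha0 : 0 ≤ a := by rw [ha]; positivity
  have ha1 : a < 1 := by rw [ha, div_lt_one hz0]; exact hz
  refine ⟨a • z, by rw [norm_smul, Real.norm_of_nonneg ha0, haz], fun u hu => ?_⟩
  have hinner : ⟪u, z⟫ ≤ a * ‖z‖ ^ 2 := by
    calc ⟪u, z⟫ ≤ ‖u‖ * ‖z‖ := real_inner_le_norm u z
      _ ≤ R * ‖z‖ := by gcongr
      _ = a * ‖z‖ ^ 2 := by rw [← haz]; ring
  apply (sq_le_sq₀ (norm_nonneg _) (norm_nonneg _)).1
  rw [norm_sub_sq_real, norm_sub_sq_real, norm_smul, Real.norm_of_nonneg ha0, inner_smul_right]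
  nlinarith [mul_nonneg (sub_nonneg.2 ha1.le) (sub_nonneg.2 hinner),
    mul_nonneg (mul_self_nonneg (1 - a)) (sq_nonneg ‖z‖)]

/-- A Markov-type bound on the points of `S ⊆ Y` with `2 f - t > T`, given a second moment bound
for `f` over `Y`. -/
theorem card_filter_lt_two_mul_sub_le {α : Type*} {Y S : Finset α} (hS : S ⊆ Y) (f : α → ℝ)
    {s t T δ γ : ℝ} (hs : 0 ≤ s) (ht : 0 ≤ t) (hδ : 0 < δ) (hγ : 0 < γ)
    (hT : s / (γ * δ) ≤ T) (hcard : δ * (Y.card : ℝ) ≤ (S.card : ℝ))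
    (hsum : ∑ y ∈ Y, f y ^ 2 ≤ (Y.card : ℝ) * (s * t)) :
    (((S.filter fun y => T < 2 * f y - t).card : ℕ) : ℝ) ≤ γ * S.card := by
  classical
  set B := S.filter fun y => T < 2 * f y - t with hB
  have hT0 : 0 ≤ T := le_trans (by positivity) hT
  have hsq : ∀ y ∈ B, s / (γ * δ) * t < f y ^ 2 := by
    intro y hy
    have hy' : T < 2 * f y - t := (Finset.mem_filter.1 hy).2
    nlinarith [mul_le_mul_of_nonneg_right hT ht, sq_nonneg (T - t)]
  rcases B.eq_empty_or_nonempty with hBe | hBne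
  · rw [hBe]
    simp only [Finset.card_empty, Nat.cast_zero]
    positivity
  have hlt : (B.card : ℝ) * (s / (γ * δ) * t) < (Y.card : ℝ) * (s * t) := by
    calc (B.card : ℝ) * (s / (γ * δ) * t) = ∑ _y ∈ B, s / (γ * δ) * t := by simp
      _ < ∑ y ∈ B, f y ^ 2 := Finset.sum_lt_sum_of_nonempty hBne hsq
      _ ≤ ∑ y ∈ Y, f y ^ 2 := Finset.sum_le_sum_of_subset_of_nonneg
          ((Finset.filter_subset _ _).trans hS) fun _ _ _ => sq_nonneg _
      _ ≤ _ := hsum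
  have hst0 : 0 ≤ s * t := mul_nonneg hs ht
  have hlt' : (B.card : ℝ) * (s * t) < (Y.card : ℝ) * (γ * δ) * (s * t) := by
    have hmul := mul_lt_mul_of_pos_right hlt (mul_pos hγ hδ)
    have heq : (B.card : ℝ) * (s / (γ * δ) * t) * (γ * δ) = (B.card : ℝ) * (s * t) := by
      field_simp
    linarith
  have hBY := lt_of_mul_lt_mul_right hlt' hst0
  nlinarith

/-- **Coarse-to-fine refinement.** Given `Y' ⊆ B(0,R')` whose empirical
covariance (described by its spectral decomposition: an orthonormal eigenbasis `v` with
eigenvalues `lam` sorted in decreasing order) has `(q+1)`-th largest eigenvalue at most `σ²`,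
and `Y* ⊆ Y'` with `|Y*| ≥ δ|Y'|` lying in a ball `B(c*, R*)` with `R' ≤ 2R*`, there is a
list of at most `(3R'/τ)^q` candidate centers, one of which captures a `(1-γ)` fraction of
`Y*` within the stated squared distance bound (with `Π_high` the projection onto the top-`q`
eigenspace and `Π_low = I − Π_high`). -/
theorem coarse_to_fine_refinement
    {d q : ℕ} (hq1 : 1 ≤ q) (hqd : q < d)
    (Y' Ystar : Finset (EuclideanSpace ℝ (Fin d)))
    (R' Rstar σ δ γ τ : ℝ) (cstar : EuclideanSpace ℝ (Fin d))
    (hY' : ∀ y ∈ Y', y ∈ Metric.closedBall (0 : EuclideanSpace ℝ (Fin d)) R')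
    (hsub : Ystar ⊆ Y')
    (hYstarB : ∀ y ∈ Ystar, y ∈ Metric.closedBall cstar Rstar)
    (hδ0 : 0 < δ) (hδ1 : δ ≤ 1) (hcard : δ * (Y'.card : ℝ) ≤ (Ystar.card : ℝ))
    (hR' : R' ≤ 2 * Rstar) (hγ0 : 0 < γ) (hγ1 : γ < 1) (hτ0 : 0 < τ) (hτR : τ < R')
    (μ : EuclideanSpace ℝ (Fin d)) (hμ : μ = (Y'.card : ℝ)⁻¹ • ∑ y ∈ Y', y)
    (v : Fin d → EuclideanSpace ℝ (Fin d)) (lam : Fin d → ℝ)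
    (horth : ∀ i j, ⟪v i, v j⟫ = if i = j then (1 : ℝ) else 0)
    (hsorted : ∀ i j : Fin d, i ≤ j → lam j ≤ lam i)
    (hspec : ∀ x : EuclideanSpace ℝ (Fin d),
      (Y'.card : ℝ)⁻¹ • ∑ y ∈ Y', ⟪y - μ, x⟫ • (y - μ) =
        ∑ i, (lam i * ⟪v i, x⟫) • v i)
    (hσ : lam ⟨q, hqd⟩ ≤ σ ^ 2) :
    ∃ C : Finset (EuclideanSpace ℝ (Fin d)),
      (C.card : ℝ) ≤ (3 * R' / τ) ^ q ∧
      ∃ Yhat ⊆ Ystar, (1 - γ) * (Ystar.card : ℝ) ≤ (Yhat.card : ℝ) ∧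
        ∃ chat ∈ C, ∀ y ∈ Yhat,
          ‖y - chat‖ ^ 2 ≤
            ‖(y - cstar) - ∑ i ∈ Finset.univ.filter (fun i : Fin d => (i : ℕ) < q),
                ⟪v i, y - cstar⟫ • v i‖ ^ 2
            + (σ ^ 2 / γ) * (1 + 2 * (1 - δ) / δ)
            + (‖∑ i ∈ Finset.univ.filter (fun i : Fin d => (i : ℕ) < q),
                ⟪v i, y - cstar⟫ • v i‖ + τ) ^ 2 := by
  classical
  have hR0 : 0 < R' := hτ0.trans hτR
  have hv : Orthonormal ℝ v := orthonormal_iff_ite.2 horth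
  set I := Finset.univ.filter (fun i : Fin d => (i : ℕ) < q) with hI
  have hIcard : I.card = q := by
    rw [hI, Fin.card_filter_val_lt, min_eq_right hqd.le]
  set V : Submodule ℝ (EuclideanSpace ℝ (Fin d)) :=
    Submodule.span ℝ ((I.image v : Finset _) : Set (EuclideanSpace ℝ (Fin d))) with hV
  have hvV : ∀ i ∈ I, v i ∈ V := fun i hi =>
    Submodule.subset_span (Finset.mem_coe.2 (Finset.mem_image_of_mem v hi))
  have hfin : Module.finrank ℝ V ≤ q :=
    (finrank_span_finset_le_card _).trans (Finset.card_image_le.trans hIcard.le)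
  have hproj : ∀ x, ∑ i ∈ I, ⟪v i, x⟫ • v i = V.starProjection x := by
    intro x
    symm
    apply Submodule.eq_starProjection_of_mem_of_inner_eq_zero
    · exact V.sum_mem fun i hi => V.smul_mem _ (hvV i hi)
    · intro w hw
      induction hw using Submodule.span_induction with
      | mem w hw =>
        obtain ⟨j, hj, rfl⟩ := Finset.mem_image.1 (Finset.mem_coe.1 hw)
        rw [inner_sub_left, sum_inner]
        simp only [real_inner_smul_left, horth, mul_ite, mul_one, mul_zero,
          Finset.sum_ite_eq', hj, if_true]
        rw [real_inner_comm, sub_self]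
      | zero => simp
      | add a b _ _ ha hb => rw [inner_add_right, ha, hb, add_zero]
      | smul a b _ hb => rw [inner_smul_right, hb, mul_zero]
  simp only [hproj]
  obtain ⟨net, hnet, hcover⟩ := exists_finset_net_closedBall (E := V) hR0.le hτ0
  obtain ⟨p, hp, hpclose⟩ :=
    exists_norm_le_forall_norm_sub_le hR0.le (V.orthogonalProjectionOnto cstar)
  obtain ⟨c, hc, hpc⟩ := hcover p hp
  set T := (σ ^ 2 / γ) * (1 + 2 * (1 - δ) / δ) with hT
  have hTle : σ ^ 2 / (γ * δ) ≤ T := by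
    have heq : T = σ ^ 2 / (γ * δ) * (1 + (1 - δ)) := by rw [hT]; field_simp; ring
    rw [heq]
    exact le_mul_of_one_le_right (by positivity) (by linarith)
  set w := (cstar - μ) - V.starProjection (cstar - μ) with hw
  have hwV : w ∈ Vᗮ := V.sub_starProjection_mem_orthogonal _
  have hsecond : ∑ y ∈ Y', ⟪y - μ, w⟫ ^ 2 ≤ (Y'.card : ℝ) * (σ ^ 2 * ‖w‖ ^ 2) := by
    rcases Y'.eq_empty_or_nonempty with hY | hY
    · simp [hY]
    have hn : (0 : ℝ) < Y'.card := by exact_mod_cast hY.card_pos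
    have h := congrArg (fun x => ⟪x, w⟫) (hspec w)
    simp only [inner_smul_left, sum_inner, RCLike.conj_to_real] at h
    have hle : ∑ i, lam i * ⟪v i, w⟫ * ⟪v i, w⟫ ≤ σ ^ 2 * ‖w‖ ^ 2 := by
      calc ∑ i, lam i * ⟪v i, w⟫ * ⟪v i, w⟫ ≤ ∑ i, σ ^ 2 * ‖⟪v i, w⟫‖ ^ 2 := by
            refine Finset.sum_le_sum fun i _ => ?_
            rw [Real.norm_eq_abs, sq_abs]
            by_cases hi : (i : ℕ) < q
            · have h0 : ⟪v i, w⟫ = 0 :=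
                (Submodule.mem_orthogonal V w).1 hwV _ (hvV i (by simp [hI, hi]))
              simp [h0]
            · have hlam : lam i ≤ σ ^ 2 :=
                (hsorted ⟨q, hqd⟩ i (Fin.le_def.2 (not_lt.1 hi))).trans hσ
              nlinarith [mul_le_mul_of_nonneg_right hlam (sq_nonneg ⟪v i, w⟫)]
        _ = σ ^ 2 * ∑ i, ‖⟪v i, w⟫‖ ^ 2 := by rw [Finset.mul_sum]
        _ ≤ σ ^ 2 * ‖w‖ ^ 2 :=
            mul_le_mul_of_nonneg_left (hv.sum_inner_products_le w) (sq_nonneg σ)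
    rw [← h, inv_mul_le_iff₀ hn] at hle
    simpa only [sq] using hle
  have hbad := card_filter_lt_two_mul_sub_le hsub (fun y => ⟪y - μ, w⟫) (sq_nonneg σ)
    (sq_nonneg ‖w‖) hδ0 hγ0 hTle hcard hsecond
  refine ⟨net.image fun x : V => (x : EuclideanSpace ℝ (Fin d)) + (μ - V.starProjection μ), ?_,
    Ystar.filter fun y => ¬ T < 2 * ⟪y - μ, w⟫ - ‖w‖ ^ 2, Finset.filter_subset _ _, ?_,
    _, Finset.mem_image_of_mem _ hc, ?_⟩
  · have hbase : 1 + 2 * R' / τ ≤ 3 * R' / τ := by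
      have hone : 1 ≤ R' / τ := (one_le_div hτ0).2 hτR.le
      have heq : 3 * R' / τ = R' / τ + 2 * R' / τ := by ring
      linarith
    have hone : 1 ≤ 1 + 2 * R' / τ := le_add_of_nonneg_right (by positivity)
    calc ((net.image _).card : ℝ) ≤ net.card := by exact_mod_cast Finset.card_image_le
      _ ≤ (1 + 2 * R' / τ) ^ Module.finrank ℝ V := hnet
      _ ≤ (1 + 2 * R' / τ) ^ q := pow_le_pow_right₀ hone hfin
      _ ≤ (3 * R' / τ) ^ q := by gcongr
  · have hsplit : ((Ystar.filter fun y => T < 2 * ⟪y - μ, w⟫ - ‖w‖ ^ 2).card : ℝ) +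
        (Ystar.filter fun y => ¬ T < 2 * ⟪y - μ, w⟫ - ‖w‖ ^ 2).card = Ystar.card := by
      exact_mod_cast Finset.card_filter_add_card_filter_not _
    linarith
  · intro y hy
    obtain ⟨hyS, hyT⟩ := Finset.mem_filter.1 hy
    have hynorm : ‖y‖ ≤ R' := by simpa using hY' y (hsub hyS)
    have hhigh : ‖V.starProjection y - c‖ ≤ ‖V.starProjection (y - cstar)‖ + τ := by
      have h1 := hpclose (V.orthogonalProjectionOnto y)
        ((V.norm_orthogonalProjectionOnto_apply_le y).trans hynorm)
      have h2 : ‖V.orthogonalProjectionOnto y - c‖ ≤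
          ‖V.orthogonalProjectionOnto y - p‖ + ‖p - c‖ := norm_sub_le_norm_sub_add_norm_sub _ _ _
      rw [← map_sub] at h1
      exact h2.trans (add_le_add h1 hpc)
    set b := (y - μ) - V.starProjection (y - μ) with hb
    have hbV : b ∈ Vᗮ := V.sub_starProjection_mem_orthogonal _
    have hinner : ⟪b, w⟫ = ⟪y - μ, w⟫ := by
      rw [hb, inner_sub_left,
        (Submodule.mem_orthogonal V w).1 hwV _ (V.starProjection_apply_mem _), sub_zero]
    have hlow : ‖b‖ ^ 2 ≤ ‖(y - cstar) - V.starProjection (y - cstar)‖ ^ 2 + T := by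
      have heq : (y - cstar) - V.starProjection (y - cstar) = b - w := by
        simp only [hb, hw, map_sub]; abel
      have hexp := norm_sub_sq_real b w
      rw [hinner] at hexp
      rw [heq, hexp]
      linarith
    have hpyth : ‖y - (c + (μ - V.starProjection μ))‖ ^ 2 =
        ‖V.starProjection y - c‖ ^ 2 + ‖b‖ ^ 2 := by
      have heq : y - (c + (μ - V.starProjection μ)) = (V.starProjection y - c) + b := by
        simp only [hb, map_sub]; abel
      have horth0 : ⟪V.starProjection y - (c : EuclideanSpace ℝ (Fin d)), b⟫ = 0 :=
        (Submodule.mem_orthogonal V b).1 hbV _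
          (V.sub_mem (V.starProjection_apply_mem _) c.2)
      rw [heq, norm_add_sq_real, horth0]
      ring
    rw [hpyth]
    have hsq := pow_le_pow_left₀ (norm_nonneg _) hhigh 2
    linarith
end

section
/- Let a₁, …, a_k, b₁, …, b_k ≥ 0 be real numbers such that ∑_{i=1}^k a_i ≥ β and ∑_{i=1}^k a_i ≥ γ · ∑_{i=1}^k b_i (with β, γ > 0). Then there exists an index i ∈ {1, …, k} such that a_i ≥ β/(2k) and a_i ≥ (γ/2) · b_i. -/
open Finset

/-- **Averaging claim.** If `∑ aᵢ ≥ β` and `∑ aᵢ ≥ γ ∑ bᵢ` for non-negative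
reals, then some index satisfies both `aᵢ ≥ β/(2k)` and `aᵢ ≥ (γ/2) bᵢ`. -/
theorem averaging_claim
    {k : ℕ} (hk : 1 ≤ k) (a b : Fin k → ℝ) (β γ : ℝ)
    (ha : ∀ i, 0 ≤ a i) (hb : ∀ i, 0 ≤ b i)
    (hβ : 0 < β) (hγ : 0 < γ)
    (hsum : β ≤ ∑ i, a i) (hratio : γ * ∑ i, b i ≤ ∑ i, a i) :
    ∃ i : Fin k, β / (2 * k) ≤ a i ∧ (γ / 2) * b i ≤ a i := by
  by_contra! h
  have : Nonempty (Fin k) := ⟨⟨0, hk⟩⟩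
  have hlt : ∀ i, a i < β / (2 * k) + γ / 2 * b i := fun i => by
    have hb' : 0 ≤ γ / 2 * b i := mul_nonneg (by positivity) (hb i)
    have hβ' : 0 < β / (2 * k) := by
      have : (0 : ℝ) < k := by exact_mod_cast hk
      positivity
    rcases lt_or_ge (a i) (β / (2 * k)) with hi | hi
    · linarith
    · linarith [h i hi]
  have hsum_lt : ∑ i, a i < ∑ i, (β / (2 * k) + γ / 2 * b i) :=
    sum_lt_sum_of_nonempty univ_nonempty fun i _ => hlt i
  have hconst : (k : ℝ) * (β / (2 * k)) = β / 2 := by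
    have : (k : ℝ) ≠ 0 := by exact_mod_cast (show k ≠ 0 by omega)
    field_simp
  rw [sum_add_distrib, ← mul_sum, sum_const, card_univ, Fintype.card_fin, nsmul_eq_mul,
    hconst] at hsum_lt
  linarith
end

section
/- Let G = (V, E) be a simple D-regular graph, let S ⊆ V with |S| = k ≥ 1, let 0 < η ≤ 1/16, and suppose the number of edges leaving S satisfies |E(S, V∖S)| ≤ η k D. For each vertex i let u_i ∈ ℝ^{|E|} be its edge-incidence vector, and let c* ∈ ℝ^{|E|} be defined by c*(e) = 2/k if e ∈ E(S,S) and c*(e) = 0 otherwise. Define S* = {i ∈ S : deg_S(i) ≥ (1 − √η) D}, where deg_S(i) is the number of neighbors of i in S. Then |S*| ≥ (1 − √η)|S|, and every i ∈ S* satisfies ‖u_i − c*‖₂² ≤ D − (1 − 2√η)·(2D/k) ≤ D − D/k. -/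
open Finset
open scoped Classical

theorem SimpleGraph.card_filter_mem_edgeFinset {V : Type*} [Fintype V] [DecidableEq V]
    (G : SimpleGraph V) [DecidableRel G.Adj] (i : V) :
    #{e ∈ G.edgeFinset | i ∈ e} = G.degree i := by
  rw [← G.card_incidenceFinset_eq_degree, G.incidenceFinset_eq_filter]

theorem SimpleGraph.two_mul_card_edges_inside_le {V : Type*} [Fintype V] [DecidableEq V]
    (G : SimpleGraph V) [DecidableRel G.Adj] {D : ℕ} (hreg : G.IsRegularOfDegree D)
    (S : Finset V) :
    2 * #{e ∈ G.edgeFinset | ∀ a ∈ e, a ∈ S} ≤ #S * D := by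
  rw [mul_comm]
  refine Finset.card_mul_le_card_mul (fun (e : Sym2 V) (a : V) => a ∈ e) ?_ ?_
  · intro e he
    induction e with | _ a b
    simp only [mem_filter, SimpleGraph.mem_edgeFinset, SimpleGraph.mem_edgeSet, Sym2.mem_iff,
      forall_eq_or_imp, forall_eq] at he
    obtain ⟨hadj, ha, hb⟩ := he
    rw [← Finset.card_pair hadj.ne]
    refine Finset.card_le_card fun x hx => ?_
    simp only [mem_insert, mem_singleton] at hx
    rcases hx with rfl | rfl <;> simp [Finset.bipartiteAbove, ha, hb]
  · intro a _
    rw [← hreg.degree_eq a, ← G.card_filter_mem_edgeFinset a]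
    refine Finset.card_le_card fun e he => ?_
    simp only [Finset.bipartiteBelow, mem_filter] at he ⊢
    exact ⟨he.1.1, he.2⟩

theorem SimpleGraph.card_adj_le_card_edges_inside {V : Type*} [Fintype V] [DecidableEq V]
    (G : SimpleGraph V) [DecidableRel G.Adj] {S : Finset V} {i : V} (hi : i ∈ S) :
    #{j ∈ S | G.Adj i j} ≤ #{e ∈ G.edgeFinset | i ∈ e ∧ ∀ a ∈ e, a ∈ S} := by
  refine Finset.card_le_card_of_injOn (fun j => s(i, j)) ?_ ?_
  · intro j hj
    simp only [coe_filter, Set.mem_ofPred_eq] at hj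
    simp [hj.1, hj.2, hi]
  · intro a _ b _ h
    exact Sym2.congr_right.1 h

theorem SimpleGraph.sum_card_adj_compl_le_ncard_cut {V : Type*} [Fintype V] [DecidableEq V]
    (G : SimpleGraph V) [DecidableRel G.Adj] (S : Finset V) :
    ∑ i ∈ S, #{j ∈ Sᶜ | G.Adj i j} ≤
      ({e ∈ G.edgeSet | ∃ a ∈ S, ∃ b ∉ S, e = s(a, b)} : Set (Sym2 V)).ncard := by
  rw [← Finset.card_sigma, ← Set.ncard_coe_finset]
  refine Set.ncard_le_ncard_of_injOn (fun p => s(p.1, p.2)) ?_ ?_ (Set.toFinite _)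
  · rintro ⟨a, b⟩ h
    simp only [coe_sigma, coe_filter, Set.mem_sigma_iff, mem_coe, Set.mem_ofPred_eq,
      mem_compl] at h
    exact ⟨h.2.2, a, h.1, b, h.2.1, rfl⟩
  · rintro ⟨a, b⟩ h ⟨c, d⟩ h' heq
    simp only [coe_sigma, coe_filter, Set.mem_sigma_iff, mem_coe, Set.mem_ofPred_eq,
      mem_compl] at h h'
    rcases Sym2.eq_iff.1 heq with ⟨rfl, rfl⟩ | ⟨rfl, rfl⟩
    · rfl
    · exact absurd h.1 h'.2.1

theorem SimpleGraph.card_adj_add_card_adj_compl {V : Type*} [Fintype V] [DecidableEq V]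
    (G : SimpleGraph V) [DecidableRel G.Adj] (S : Finset V) (i : V) :
    #{j ∈ S | G.Adj i j} + #{j ∈ Sᶜ | G.Adj i j} = G.degree i := by
  rw [← G.card_neighborFinset_eq_degree, G.neighborFinset_eq_filter, ← Finset.union_compl S,
    Finset.filter_union, Finset.card_union_of_disjoint]
  exact Finset.disjoint_filter_filter disjoint_compl_right

/-- **Completeness gadget.** In a simple `D`-regular graph, if `S` has `k`
vertices and at most `ηkD` outgoing edges (`0 < η ≤ 1/16`), then the set
`S* = {i ∈ S : deg_S(i) ≥ (1-√η)D}` has `|S*| ≥ (1-√η)|S|`, and for the center `c*`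
(with value `2/k` on edges inside `S` and `0` elsewhere), every `i ∈ S*` satisfies
`‖u_i - c*‖² ≤ D - (1-2√η)(2D/k) ≤ D - D/k`. -/
theorem sse_completeness_gadget
    {V : Type*} [Fintype V] [DecidableEq V] (G : SimpleGraph V) [DecidableRel G.Adj]
    (D k : ℕ) (hreg : G.IsRegularOfDegree D)
    (S : Finset V) (hSk : S.card = k) (hk1 : 1 ≤ k)
    (η : ℝ) (hη0 : 0 < η) (hη : η ≤ 1 / 16)
    (hcut : ((({e ∈ G.edgeSet | ∃ a ∈ S, ∃ b ∉ S, e = s(a, b)} : Set (Sym2 V)).ncard : ℝ))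
      ≤ η * k * D)
    (u : V → Sym2 V → ℝ)
    (hu : ∀ i e, u i e = if i ∈ e then (1 : ℝ) else 0)
    (cstar : Sym2 V → ℝ)
    (hcstar : ∀ e, cstar e =
      if e ∈ G.edgeSet ∧ (∀ a ∈ e, a ∈ S) then 2 / (k : ℝ) else 0)
    (Sstar : Finset V)
    (hSstar : ∀ i, i ∈ Sstar ↔ (i ∈ S ∧
      (1 - Real.sqrt η) * D ≤ (((S.filter fun j => G.Adj i j).card : ℝ)))) :
    (1 - Real.sqrt η) * (S.card : ℝ) ≤ (Sstar.card : ℝ) ∧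
    ∀ i ∈ Sstar,
      ∑ e ∈ G.edgeFinset, (u i e - cstar e) ^ 2 ≤
        (D : ℝ) - (1 - 2 * Real.sqrt η) * (2 * (D : ℝ) / k) ∧
      (D : ℝ) - (1 - 2 * Real.sqrt η) * (2 * (D : ℝ) / k) ≤ (D : ℝ) - (D : ℝ) / k := by
  obtain ⟨s, hs⟩ : ∃ s, s = Real.sqrt η := ⟨_, rfl⟩
  have hs0 : 0 < s := hs ▸ Real.sqrt_pos.2 hη0
  have hsq : s * s = η := hs ▸ Real.mul_self_sqrt hη0.le
  have hs4 : s ≤ 1 / 4 := by nlinarith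
  have hk : (0 : ℝ) < k := by exact_mod_cast hk1
  have hD : (0 : ℝ) ≤ D := Nat.cast_nonneg D
  rw [← hs]
  simp only [← hs] at hSstar
  refine ⟨?_, fun i hi => ⟨?_, ?_⟩⟩
  · have hsub : Sstar ⊆ S := fun i hi => ((hSstar i).1 hi).1
    rcases hD.eq_or_lt with hD0 | hDpos
    · have hsup : S ⊆ Sstar := fun i hi => (hSstar i).2 ⟨hi, by simp [← hD0]⟩
      have hle : (#S : ℝ) ≤ #Sstar := by exact_mod_cast Finset.card_le_card hsup
      nlinarith [Nat.cast_nonneg (α := ℝ) #S]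
    · have hbad : ∀ i ∈ S \ Sstar, s * D ≤ (#{j ∈ Sᶜ | G.Adj i j} : ℝ) := by
        intro i hi
        obtain ⟨hiS, hin⟩ := Finset.mem_sdiff.1 hi
        have hlt := not_le.1 fun h => hin ((hSstar i).2 ⟨hiS, h⟩)
        have hdeg : (#{j ∈ S | G.Adj i j} : ℝ) + #{j ∈ Sᶜ | G.Adj i j} = D := by
          exact_mod_cast (G.card_adj_add_card_adj_compl S i).trans (hreg.degree_eq i)
        linarith
      have hsum := Finset.card_nsmul_le_sum _ _ _ hbad
      have hmono : ∑ i ∈ S \ Sstar, (#{j ∈ Sᶜ | G.Adj i j} : ℝ) ≤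
          ∑ i ∈ S, (#{j ∈ Sᶜ | G.Adj i j} : ℝ) :=
        Finset.sum_le_sum_of_subset_of_nonneg Finset.sdiff_subset
          fun _ _ _ => Nat.cast_nonneg _
      have hncard : ∑ i ∈ S, (#{j ∈ Sᶜ | G.Adj i j} : ℝ) ≤ η * k * D :=
        le_trans (by exact_mod_cast G.sum_card_adj_compl_le_ncard_cut S) hcut
      have hcard : (#(S \ Sstar) : ℝ) + #Sstar = #S := by
        exact_mod_cast Finset.card_sdiff_add_card_eq_card hsub
      have hbound : (#(S \ Sstar) : ℝ) * (s * D) ≤ (s * k) * (s * D) := by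
        rw [nsmul_eq_mul] at hsum
        calc _ ≤ η * k * D := hsum.trans (hmono.trans hncard)
          _ = _ := by rw [← hsq]; ring
      have hle := le_of_mul_le_mul_right hbound (mul_pos hs0 hDpos)
      rw [← hSk] at hle
      linarith
  · obtain ⟨hiS, hdeg⟩ := (hSstar i).1 hi
    have hterm : ∀ e ∈ G.edgeFinset, (u i e - cstar e) ^ 2 =
        (if i ∈ e then (1 : ℝ) else 0)
          - 4 / k * (if i ∈ e ∧ ∀ a ∈ e, a ∈ S then 1 else 0)
          + 4 / k ^ 2 * (if ∀ a ∈ e, a ∈ S then 1 else 0) := by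
      intro e he
      have he' : e ∈ G.edgeSet := SimpleGraph.mem_edgeFinset.1 he
      rw [hu, hcstar]
      split_ifs <;> first | ring1 | tauto
    rw [Finset.sum_congr rfl hterm, Finset.sum_add_distrib, Finset.sum_sub_distrib,
      ← Finset.mul_sum, ← Finset.mul_sum, Finset.sum_boole, Finset.sum_boole, Finset.sum_boole]
    have hinc : (#{e ∈ G.edgeFinset | i ∈ e} : ℝ) = D := by
      exact_mod_cast (G.card_filter_mem_edgeFinset i).trans (hreg.degree_eq i)
    have hcross : (1 - s) * D ≤ (#{e ∈ G.edgeFinset | i ∈ e ∧ ∀ a ∈ e, a ∈ S} : ℝ) :=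
      hdeg.trans (by exact_mod_cast G.card_adj_le_card_edges_inside hiS)
    have hinside : 2 * (#{e ∈ G.edgeFinset | ∀ a ∈ e, a ∈ S} : ℝ) ≤ k * D := by
      rw [← hSk]
      exact_mod_cast G.two_mul_card_edges_inside_le hreg S
    have hcross' := mul_le_mul_of_nonneg_left hcross (by positivity : (0 : ℝ) ≤ 4 / k)
    have hinside' : 4 / (k : ℝ) ^ 2 * #{e ∈ G.edgeFinset | ∀ a ∈ e, a ∈ S} ≤ 2 * D / k := by
      rw [div_mul_eq_mul_div, div_le_div_iff₀ (by positivity) hk]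
      nlinarith [mul_le_mul_of_nonneg_left hinside hk.le]
    have hfinal : (D : ℝ) - (1 - 2 * s) * (2 * (D : ℝ) / k) =
        D - 4 / k * ((1 - s) * D) + 2 * D / k := by ring
    rw [hinc, hfinal]
    linarith
  · have hDk : 0 ≤ (D : ℝ) / k := by positivity
    rw [mul_div_assoc]
    nlinarith
end
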